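/- arXiv:1204.6407 — 3 statements merged into one kernel-verified Lean document; each statement's English description precedes it below -/
import Mathlib

section
/- Let F be a real normed vector space, let x ∈ F and let (xₙ)_{n≥1} be a sequence in F converging rapidly to x, i.e. for every k ∈ ℕ there exists C > 0 with n^k‖xₙ − x‖ ≤ C for all n ≥ 1. Then there exists an infinitely differentiable curve c : ℝ → F such that c(0) = x and c(1/n) = xₙ for every n ≥ 1. -/
open Filter Topology

/-- Rapid decay: `n ↦ (n + 1) ^ k * ‖v n‖` is bounded for every `k`. -/
def RapidlyDecreasing {F : Type*} [NormedAddCommGroup F] (v : ℕ → F) : Prop :=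
  ∀ k : ℕ, ∃ C : ℝ, ∀ n : ℕ, ((n : ℝ) + 1) ^ k * ‖v n‖ ≤ C

/-- The affine map sending `1 / (n + 1)` to `0`, with slope `2 (n + 1) ^ 2`. -/
noncomputable def harmonicRescale (n : ℕ) (t : ℝ) : ℝ :=
  2 * ((n : ℝ) + 1) ^ 2 * (t - 1 / ((n : ℝ) + 1))

/-- The series of copies of `ψ`, recentred at the points `1 / (n + 1)`, with coefficients `v`. -/
noncomputable def bumpSeries {F : Type*} [NormedAddCommGroup F] [NormedSpace ℝ F]
    (ψ : ℝ → ℝ) (v : ℕ → F) (t : ℝ) : F :=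
  ∑' n, ψ (harmonicRescale n t) • v n

lemma harmonicRescale_eq (n : ℕ) (t : ℝ) :
    harmonicRescale n t = 2 * ((n : ℝ) + 1) * (((n : ℝ) + 1) * t - 1) := by
  unfold harmonicRescale
  field_simp

lemma hasDerivAt_harmonicRescale (n : ℕ) (t : ℝ) :
    HasDerivAt (harmonicRescale n) (2 * ((n : ℝ) + 1) ^ 2) t := by
  unfold harmonicRescale
  simpa using
    ((hasDerivAt_id t).sub_const (1 / ((n : ℝ) + 1))).const_mul (2 * ((n : ℝ) + 1) ^ 2)

lemma one_le_two_mul_of_abs_harmonicRescale_le_one {n : ℕ} {t : ℝ}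
    (h : |harmonicRescale n t| ≤ 1) : 1 ≤ 2 * (((n : ℝ) + 1) * t) := by
  rw [harmonicRescale_eq] at h
  have hn : (0 : ℝ) ≤ n := n.cast_nonneg
  nlinarith [(abs_le.1 h).1]

lemma mul_le_two_of_abs_harmonicRescale_le_one {n : ℕ} {t : ℝ}
    (h : |harmonicRescale n t| ≤ 1) : ((n : ℝ) + 1) * t ≤ 2 := by
  rw [harmonicRescale_eq] at h
  have hn : (0 : ℝ) ≤ n := n.cast_nonneg
  nlinarith [(abs_le.1 h).2]

lemma one_le_abs_harmonicRescale {m n : ℕ} (h : m ≠ n) :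
    1 ≤ |harmonicRescale m (1 / ((n : ℝ) + 1))| := by
  have hm : (0 : ℝ) ≤ m := m.cast_nonneg
  have hn : (0 : ℝ) ≤ n := n.cast_nonneg
  have e : harmonicRescale m (1 / ((n : ℝ) + 1))
      = 2 * ((m : ℝ) + 1) * ((m : ℝ) - n) / ((n : ℝ) + 1) := by
    rw [harmonicRescale_eq]
    field_simp
    ring
  rw [e, abs_div, abs_of_pos (by positivity : (0 : ℝ) < n + 1), le_div_iff₀ (by positivity),
    abs_mul, abs_of_pos (by positivity : (0 : ℝ) < 2 * (m + 1))]
  rcases lt_or_gt_of_ne h with h | h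
  · have h' : (m : ℝ) + 1 ≤ n := by exact_mod_cast h
    rw [abs_of_nonpos (by linarith)]
    nlinarith
  · have h' : (n : ℝ) + 1 ≤ m := by exact_mod_cast h
    rw [abs_of_nonneg (by linarith)]
    nlinarith

lemma RapidlyDecreasing.mul_sq {F : Type*} [NormedAddCommGroup F] [NormedSpace ℝ F]
    {v : ℕ → F} (hv : RapidlyDecreasing v) :
    RapidlyDecreasing fun n => (2 * ((n : ℝ) + 1) ^ 2) • v n := by
  intro k
  obtain ⟨C, hC⟩ := hv (k + 2)
  refine ⟨2 * C, fun n => ?_⟩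
  rw [norm_smul, Real.norm_of_nonneg (by positivity)]
  calc _ = 2 * (((n : ℝ) + 1) ^ (k + 2) * ‖v n‖) := by ring
    _ ≤ 2 * C := by linarith [hC n]

section

variable {F : Type*} [NormedAddCommGroup F] [NormedSpace ℝ F] {ψ : ℝ → ℝ} {v : ℕ → F}

lemma abs_le_one_of_ne_zero_of_tsupport_subset (hs : tsupport ψ ⊆ Metric.closedBall 0 1)
    {s : ℝ} (h : ψ s ≠ 0) : |s| ≤ 1 := by
  simpa using hs (subset_tsupport ψ h)

lemma bumpSeries_zero (hs : tsupport ψ ⊆ Metric.closedBall 0 1) : bumpSeries ψ v 0 = 0 := by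
  refine (tsum_congr fun n => ?_).trans tsum_zero
  have : ψ (harmonicRescale n 0) = 0 := by
    by_contra h
    have := one_le_two_mul_of_abs_harmonicRescale_le_one
      (abs_le_one_of_ne_zero_of_tsupport_subset hs h)
    norm_num at this
  rw [this, zero_smul]

/-- Away from `0`, the series is locally a finite sum, uniformly in `ψ` and `v`. -/
lemma exists_forall_bumpSeries_eq_sum {t₀ : ℝ} (ht₀ : t₀ ≠ 0) :
    ∃ N : ℕ, ∀ᶠ t in 𝓝 t₀, ∀ (ψ : ℝ → ℝ) (v : ℕ → F), tsupport ψ ⊆ Metric.closedBall 0 1 →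
      bumpSeries ψ v t = ∑ n ∈ Finset.range N, ψ (harmonicRescale n t) • v n := by
  have hpos : 0 < |t₀| := abs_pos.2 ht₀
  obtain ⟨N, hN⟩ := exists_nat_gt (4 / |t₀|)
  refine ⟨N, ?_⟩
  have hev : ∀ᶠ t in 𝓝 t₀, |t₀| / 2 < |t| :=
    continuous_abs.continuousAt.eventually (lt_mem_nhds (half_lt_self hpos))
  filter_upwards [hev] with t ht ψ v hs
  refine tsum_eq_sum fun n hn => ?_
  have : ψ (harmonicRescale n t) = 0 := by
    by_contra h
    have hle := abs_le_one_of_ne_zero_of_tsupport_subset hs h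
    have h1 := one_le_two_mul_of_abs_harmonicRescale_le_one hle
    have h2 := mul_le_two_of_abs_harmonicRescale_le_one hle
    have hn0 : (0 : ℝ) < (n : ℝ) + 1 := by positivity
    have ht0 : 0 < t := by
      by_contra! hneg
      nlinarith
    rw [abs_of_pos ht0] at ht
    have hNn : (N : ℝ) ≤ n := by
      exact_mod_cast not_lt.1 fun hlt => hn (Finset.mem_range.2 hlt)
    rw [div_lt_iff₀ hpos] at hN
    nlinarith
  rw [this, zero_smul]

lemma exists_norm_bumpSeries_le (hψ : Continuous ψ) (hs : tsupport ψ ⊆ Metric.closedBall 0 1)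
    (hv : RapidlyDecreasing v) : ∃ K : ℝ, ∀ t, ‖bumpSeries ψ v t‖ ≤ K * t ^ 2 := by
  have hc : HasCompactSupport ψ :=
    (isCompact_closedBall (0 : ℝ) 1).of_isClosed_subset (isClosed_tsupport ψ) hs
  obtain ⟨B, hB⟩ := hψ.bounded_above_of_compact_support hc
  obtain ⟨C, hC⟩ := hv 4
  have hB0 : 0 ≤ B := (norm_nonneg _).trans (hB 0)
  have hC0 : 0 ≤ C := le_trans (by positivity) (hC 0)
  have hsum : Summable fun n : ℕ => 1 / ((n : ℝ) + 1) ^ 2 := by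
    have := (summable_nat_add_iff 1).2 (Real.summable_one_div_nat_pow.2 one_lt_two)
    simpa using this
  refine ⟨B * (4 * C) * ∑' n : ℕ, 1 / ((n : ℝ) + 1) ^ 2, fun t => ?_⟩
  rw [mul_right_comm]
  refine tsum_of_norm_bounded (hsum.hasSum.mul_left (B * (4 * C) * t ^ 2)) fun n => ?_
  by_cases h : ψ (harmonicRescale n t) = 0
  · rw [h, zero_smul, norm_zero]
    positivity
  have h1 := one_le_two_mul_of_abs_harmonicRescale_le_one
    (abs_le_one_of_ne_zero_of_tsupport_subset hs h)
  have h2 : 1 ≤ 4 * (((n : ℝ) + 1) ^ 2 * t ^ 2) := by nlinarith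
  have h3 : ‖v n‖ ≤ 4 * C * t ^ 2 * (1 / ((n : ℝ) + 1) ^ 2) := by
    rw [mul_one_div, le_div_iff₀ (by positivity)]
    calc ‖v n‖ * ((n : ℝ) + 1) ^ 2
        ≤ ‖v n‖ * ((n : ℝ) + 1) ^ 2 * (4 * (((n : ℝ) + 1) ^ 2 * t ^ 2)) :=
          le_mul_of_one_le_right (by positivity) h2
      _ = 4 * t ^ 2 * (((n : ℝ) + 1) ^ 4 * ‖v n‖) := by ring
      _ ≤ 4 * t ^ 2 * C := by gcongr; exact hC n
      _ = 4 * C * t ^ 2 := by ring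
  calc ‖ψ (harmonicRescale n t) • v n‖ = ‖ψ (harmonicRescale n t)‖ * ‖v n‖ := norm_smul _ _
    _ ≤ B * (4 * C * t ^ 2 * (1 / ((n : ℝ) + 1) ^ 2)) := by gcongr; exact hB _
    _ = _ := by ring

lemma hasDerivAt_bumpSeries (hψ : Differentiable ℝ ψ)
    (hs : tsupport ψ ⊆ Metric.closedBall 0 1) (hv : RapidlyDecreasing v) (t : ℝ) :
    HasDerivAt (bumpSeries ψ v)
      (bumpSeries (deriv ψ) (fun n => (2 * ((n : ℝ) + 1) ^ 2) • v n) t) t := by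
  have hs' : tsupport (deriv ψ) ⊆ Metric.closedBall 0 1 :=
    tsupport_deriv_subset.trans hs
  rcases eq_or_ne t 0 with rfl | ht
  · obtain ⟨K, hK⟩ := exists_norm_bumpSeries_le hψ.continuous hs hv
    rw [bumpSeries_zero hs', hasDerivAt_iff_isLittleO_nhds_zero]
    simp only [zero_add, bumpSeries_zero hs, sub_zero, smul_zero]
    refine (Asymptotics.IsBigO.of_bound K (Eventually.of_forall fun t => ?_)).trans_isLittleO
      (Asymptotics.isLittleO_pow_id one_lt_two)
    rw [Real.norm_of_nonneg (sq_nonneg t)]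
    exact hK t
  · obtain ⟨N, hN⟩ := exists_forall_bumpSeries_eq_sum (F := F) ht
    rw [hN.self_of_nhds _ _ hs']
    refine HasDerivAt.congr_of_eventuallyEq ?_ (hN.mono fun s h => h ψ v hs)
    refine HasDerivAt.fun_sum fun n _ => ?_
    rw [smul_smul]
    exact ((hψ _).hasDerivAt.comp t (hasDerivAt_harmonicRescale n t)).smul_const (v n)

lemma contDiff_bumpSeries (hψ : ContDiff ℝ (⊤ : ℕ∞) ψ)
    (hs : tsupport ψ ⊆ Metric.closedBall 0 1) (hv : RapidlyDecreasing v) :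
    ContDiff ℝ (⊤ : ℕ∞) (bumpSeries ψ v) := by
  refine contDiff_infty.2 fun k => ?_
  induction k generalizing ψ v with
  | zero =>
    exact contDiff_zero.2 <| continuous_iff_continuousAt.2 fun t =>
      (hasDerivAt_bumpSeries (hψ.differentiable (by simp)) hs hv t).continuousAt
  | succ k ih =>
    have hd := hasDerivAt_bumpSeries (hψ.differentiable (by simp)) hs hv
    push_cast
    refine contDiff_succ_iff_deriv.2 ⟨fun t => (hd t).differentiableAt, by simp, ?_⟩
    rw [funext fun t => (hd t).deriv]
    exact ih (contDiff_infty_iff_deriv.1 hψ).2 (tsupport_deriv_subset.trans hs) hv.mul_sq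

lemma bumpSeries_one_div (h0 : ψ 0 = 1) (h1 : ∀ s, 1 ≤ |s| → ψ s = 0) (n : ℕ) :
    bumpSeries ψ v (1 / ((n : ℝ) + 1)) = v n := by
  refine (tsum_eq_single n fun m hm => ?_).trans ?_
  · rw [h1 _ (one_le_abs_harmonicRescale hm), zero_smul]
  · simp [harmonicRescale, h0]

end

/-- The special curve lemma (Kriegl–Michor) in the normed-space setting: if `(xₙ)_{n ≥ 1}`
converges rapidly to `x`, then there is a smooth curve `c : ℝ → F` with `c 0 = x` and
`c (1/n) = xₙ` for all `n ≥ 1`. -/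
theorem special_curve_lemma
    {F : Type*} [NormedAddCommGroup F] [NormedSpace ℝ F]
    (x : F) (xn : ℕ → F)
    (hrapid : ∀ k : ℕ, ∃ C > (0 : ℝ), ∀ n : ℕ, 1 ≤ n → (n : ℝ) ^ k * ‖xn n - x‖ ≤ C) :
    ∃ c : ℝ → F, ContDiff ℝ (⊤ : ℕ∞) c ∧ c 0 = x ∧ ∀ n : ℕ, 1 ≤ n → c (1 / (n : ℝ)) = xn n := by
  let φ : ContDiffBump (0 : ℝ) := ⟨1 / 2, 1, by norm_num, by norm_num⟩
  have hs : tsupport φ ⊆ Metric.closedBall 0 1 := φ.tsupport_eq.subset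
  have hv : RapidlyDecreasing fun n => xn (n + 1) - x := by
    intro k
    obtain ⟨C, -, hC⟩ := hrapid k
    exact ⟨C, fun n => by simpa using hC (n + 1) (by omega)⟩
  refine ⟨fun t => x + bumpSeries φ (fun n => xn (n + 1) - x) t,
    contDiff_const.add (contDiff_bumpSeries φ.contDiff hs hv), ?_, fun n hn => ?_⟩
  · simp only [bumpSeries_zero hs, add_zero]
  · obtain ⟨m, rfl⟩ := Nat.exists_eq_add_of_le' hn
    have h0 : φ 0 = 1 := φ.one_of_mem_closedBall (Metric.mem_closedBall_self φ.rIn_pos.le)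
    have h1 : ∀ s, 1 ≤ |s| → φ s = 0 := fun s hs => φ.zero_of_le_dist (by simpa using hs)
    push_cast
    rw [bumpSeries_one_div h0 h1, add_sub_cancel]
end

section
/- Let F be a real normed vector space and let (xₙ) be a sequence in F converging to x ∈ F. Then there exist a strictly increasing function φ : ℕ → ℕ and an infinitely differentiable curve c : ℝ → F such that c(0) = x and c(1/(j+1)) = x_{φ(j)} for every j ∈ ℕ. -/
open Filter Topology

section SmoothSeries

variable {F : Type*} [NormedAddCommGroup F] [NormedSpace ℝ F]

lemma iteratedDeriv_eventuallyEq_zero {f : ℝ → F} {t : ℝ} (h : f =ᶠ[𝓝 t] 0) (k : ℕ) :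
    iteratedDeriv k f =ᶠ[𝓝 t] 0 := by
  induction k with
  | zero => simpa using h
  | succ k ih =>
    rw [iteratedDeriv_succ]
    simpa using ih.deriv

/-- Termwise differentiation of a series that is locally finite away from `0`, each term of which
vanishes near `0`, and which is dominated by `u j * t ^ 2`. No completeness is needed. -/
lemma hasDerivAt_tsum_of_locallyFinite_away_from_zero {f : ℕ → ℝ → F} {u : ℕ → ℝ}
    (hu : Summable u) (hu0 : ∀ j, 0 ≤ u j) (hf : ∀ j, Differentiable ℝ (f j))
    (h0 : ∀ j, f j =ᶠ[𝓝 0] 0)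
    (hloc : ∀ t ≠ 0, ∃ N, ∀ᶠ s in 𝓝 t, ∀ j ≥ N, f j s = 0)
    (hb : ∀ᶠ j in atTop, ∀ t, ‖f j t‖ ≤ u j * t ^ 2) (t : ℝ) :
    HasDerivAt (fun t => ∑' j, f j t) (∑' j, deriv (f j) t) t := by
  rcases eq_or_ne t 0 with rfl | ht
  · have hd : ∀ j, deriv (f j) 0 = 0 := fun j => by simpa using (h0 j).deriv_eq
    obtain ⟨N, hN⟩ := eventually_atTop.1 hb
    have hsmall : ∀ᶠ t in 𝓝 (0 : ℝ), ‖∑' j, f j t‖ ≤ (∑' j, u j) * ‖t ^ 2‖ := by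
      have hfin : ∀ᶠ t in 𝓝 (0 : ℝ), ∀ j ∈ Finset.range N, f j t = 0 :=
        (eventually_all_finset _).2 fun j _ => h0 j
      filter_upwards [hfin] with t ht
      rw [Real.norm_of_nonneg (sq_nonneg t)]
      refine tsum_of_norm_bounded (hu.hasSum.mul_right (t ^ 2)) fun j => ?_
      by_cases hj : j < N
      · rw [ht j (Finset.mem_range.2 hj), norm_zero]
        exact mul_nonneg (hu0 j) (sq_nonneg t)
      · exact hN j (not_lt.1 hj) t
    have hO : (fun t => ∑' j, f j t) =O[𝓝 0] fun t : ℝ => t ^ 2 := .of_bound _ hsmall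
    have ho : (fun t => ∑' j, f j t) =o[𝓝 0] fun t : ℝ => t :=
      hO.trans_isLittleO (by simpa using Asymptotics.isLittleO_pow_id (𝕜 := ℝ) one_lt_two)
    have hz : ∀ j, f j 0 = 0 := fun j => (h0 j).eq_of_nhds
    rw [hasDerivAt_iff_isLittleO]
    simpa [hd, hz] using ho
  · obtain ⟨N, hN⟩ := hloc t ht
    have heq : (fun t => ∑' j, f j t) =ᶠ[𝓝 t] fun t => ∑ j ∈ Finset.range N, f j t := by
      filter_upwards [hN] with s hs
      exact tsum_eq_sum fun j hj => hs j (by simpa using hj)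
    have hd : ∑' j, deriv (f j) t = ∑ j ∈ Finset.range N, deriv (f j) t := by
      refine tsum_eq_sum fun j hj => ?_
      have : f j =ᶠ[𝓝 t] 0 := by
        filter_upwards [hN] with s hs
        exact hs j (by simpa using hj)
      simpa using this.deriv_eq
    rw [hd]
    exact (HasDerivAt.fun_sum fun j _ => (hf j t).hasDerivAt).congr_of_eventuallyEq heq

lemma contDiff_nat_tsum_of_locallyFinite_away_from_zero {u : ℕ → ℝ}
    (hu : Summable u) (hu0 : ∀ j, 0 ≤ u j) (n : ℕ) {f : ℕ → ℝ → F}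
    (hf : ∀ j, ContDiff ℝ (⊤ : ℕ∞) (f j)) (h0 : ∀ j, f j =ᶠ[𝓝 0] 0)
    (hloc : ∀ t ≠ 0, ∃ N, ∀ᶠ s in 𝓝 t, ∀ j ≥ N, f j s = 0)
    (hb : ∀ k, ∀ᶠ j in atTop, ∀ t, ‖iteratedDeriv k (f j) t‖ ≤ u j * t ^ 2) :
    ContDiff ℝ n fun t => ∑' j, f j t := by
  induction n generalizing f with
  | zero =>
    refine contDiff_zero.2 (continuous_iff_continuousAt.2 fun t => ?_)
    exact (hasDerivAt_tsum_of_locallyFinite_away_from_zero hu hu0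
      (fun j => (hf j).differentiable (by simp)) h0 hloc (by simpa using hb 0) t).continuousAt
  | succ n ih =>
    have hd := hasDerivAt_tsum_of_locallyFinite_away_from_zero hu hu0
      (fun j => (hf j).differentiable (by simp)) h0 hloc (by simpa using hb 0)
    push_cast
    refine contDiff_succ_iff_deriv.2 ⟨fun t => (hd t).differentiableAt, by simp, ?_⟩
    rw [show deriv (fun t => ∑' j, f j t) = fun t => ∑' j, deriv (f j) t from
      funext fun t => (hd t).deriv]
    refine ih (fun j => (contDiff_infty_iff_deriv.1 (hf j)).2)
      (fun j => by simpa using (h0 j).deriv) (fun t ht => ?_) fun k => ?_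
    · obtain ⟨N, hN⟩ := hloc t ht
      refine ⟨N, ?_⟩
      filter_upwards [hN.eventually_nhds] with s hs j hj
      have : f j =ᶠ[𝓝 s] 0 := hs.mono fun r hr => hr j hj
      simpa using this.deriv_eq
    · simpa only [← iteratedDeriv_succ'] using hb (k + 1)

end SmoothSeries

lemma HasCompactSupport.exists_abs_iteratedDeriv_le_mul_sq {f : ℝ → ℝ}
    (hf : ContDiff ℝ (⊤ : ℕ∞) f) (hc : HasCompactSupport f) (h0 : f =ᶠ[𝓝 0] 0) (k : ℕ) :
    ∃ B, ∀ t, |iteratedDeriv k f t| ≤ B * t ^ 2 := by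
  have hcont : Continuous (iteratedDeriv k f) :=
    hf.continuous_iteratedDeriv k (by exact_mod_cast le_top)
  have hcs : HasCompactSupport (iteratedDeriv k f) := by
    rw [iteratedDeriv_eq_equiv_comp]
    exact (hc.iteratedFDeriv k).comp_left (by simp)
  obtain ⟨M, hM⟩ := hcont.bounded_above_of_compact_support hcs
  obtain ⟨δ, hδ, hz⟩ := Metric.eventually_nhds_iff.1 (iteratedDeriv_eventuallyEq_zero h0 k)
  have hM0 : 0 ≤ M := (norm_nonneg _).trans (hM 0)
  refine ⟨M / δ ^ 2, fun t => ?_⟩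
  by_cases ht : |t| < δ
  · rw [hz (by simpa using ht)]
    simp only [Pi.zero_apply, abs_zero]
    positivity
  · have hsq : δ ^ 2 ≤ t ^ 2 := by
      rw [← sq_abs t]
      exact pow_le_pow_left₀ hδ.le (not_lt.1 ht) 2
    calc |iteratedDeriv k f t| ≤ M := hM t
      _ = M / δ ^ 2 * δ ^ 2 := by field_simp
      _ ≤ M / δ ^ 2 * t ^ 2 := by gcongr

lemma HasCompactSupport.exists_abs_iteratedDeriv_le_mul_sq_of_le {f : ℝ → ℝ}
    (hf : ContDiff ℝ (⊤ : ℕ∞) f) (hc : HasCompactSupport f) (h0 : f =ᶠ[𝓝 0] 0) (n : ℕ) :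
    ∃ B > 0, ∀ k ≤ n, ∀ t, |iteratedDeriv k f t| ≤ B * t ^ 2 := by
  choose B hB using hc.exists_abs_iteratedDeriv_le_mul_sq hf h0
  refine ⟨1 + ∑ k ∈ Finset.range (n + 1), |B k|, by positivity, fun k hk t => (hB k t).trans ?_⟩
  gcongr
  have := Finset.single_le_sum (f := fun k => |B k|) (fun _ _ => abs_nonneg _)
    (Finset.mem_range.2 (Nat.lt_succ_of_le hk))
  linarith [le_abs_self (B k)]

/-- A bump function at `1 / (j + 1)` vanishing at all other points `1 / (i + 1)`. -/
noncomputable def reciprocalBump (j : ℕ) : ContDiffBump (1 / ((j : ℝ) + 1)) where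
  rIn := 1 / (((j : ℝ) + 1) * (j + 2)) / 2
  rOut := 1 / (((j : ℝ) + 1) * (j + 2))
  rIn_pos := by positivity
  rIn_lt_rOut := half_lt_self (by positivity)

lemma reciprocalBump_self (j : ℕ) : reciprocalBump j (1 / ((j : ℝ) + 1)) = 1 :=
  (reciprocalBump j).eventuallyEq_one.eq_of_nhds

lemma reciprocalBump_of_ne {i j : ℕ} (h : j ≠ i) :
    reciprocalBump j (1 / ((i : ℝ) + 1)) = 0 := by
  apply (reciprocalBump j).zero_of_le_dist
  change 1 / (((j : ℝ) + 1) * (j + 2)) ≤ _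
  rw [Real.dist_eq, show 1 / ((i : ℝ) + 1) - 1 / ((j : ℝ) + 1) =
    ((j : ℝ) - i) / (((i : ℝ) + 1) * (j + 1)) by field_simp; ring, abs_div,
    abs_of_pos (show (0 : ℝ) < (i + 1) * (j + 1) by positivity),
    div_le_div_iff₀ (by positivity) (by positivity)]
  have h1 : (1 : ℝ) ≤ |(j : ℝ) - i| := by
    exact_mod_cast Int.one_le_abs (sub_ne_zero.2 (Nat.cast_injective.ne h : (j : ℤ) ≠ i))
  have h2 : (i : ℝ) - j ≤ |(j : ℝ) - i| := by
    rw [abs_sub_comm]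
    exact le_abs_self _
  have hj : (0 : ℝ) ≤ j := j.cast_nonneg
  have h3 : (i : ℝ) + 1 ≤ |(j : ℝ) - i| * (j + 2) := by nlinarith
  nlinarith

lemma reciprocalBump_of_le {j : ℕ} {t : ℝ} (ht : t ≤ 1 / (2 * ((j : ℝ) + 1))) :
    reciprocalBump j t = 0 := by
  apply (reciprocalBump j).zero_of_le_dist
  change 1 / (((j : ℝ) + 1) * (j + 2)) ≤ _
  have h : 1 / (((j : ℝ) + 1) * (j + 2)) ≤ 1 / (2 * ((j : ℝ) + 1)) := by
    rw [mul_comm]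
    gcongr
    linarith [(j.cast_nonneg : (0 : ℝ) ≤ j)]
  have h2 : 1 / ((j : ℝ) + 1) = 1 / (2 * ((j : ℝ) + 1)) + 1 / (2 * ((j : ℝ) + 1)) := by
    field_simp; norm_num
  rw [dist_comm, Real.dist_eq]
  exact le_trans (by linarith) (le_abs_self _)

lemma reciprocalBump_of_two_mul_le {j : ℕ} {t : ℝ} (ht : 2 * (1 / ((j : ℝ) + 1)) ≤ t) :
    reciprocalBump j t = 0 := by
  apply (reciprocalBump j).zero_of_le_dist
  change 1 / (((j : ℝ) + 1) * (j + 2)) ≤ _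
  have h : 1 / (((j : ℝ) + 1) * (j + 2)) ≤ 1 / ((j : ℝ) + 1) := by
    gcongr
    nlinarith [(j.cast_nonneg : (0 : ℝ) ≤ j)]
  rw [Real.dist_eq]
  exact le_trans (by linarith) (le_abs_self _)

lemma reciprocalBump_eventuallyEq_zero (j : ℕ) : reciprocalBump j =ᶠ[𝓝 0] 0 := by
  filter_upwards [Iio_mem_nhds (show (0 : ℝ) < 1 / (2 * ((j : ℝ) + 1)) by positivity)] with t ht
  exact reciprocalBump_of_le (le_of_lt ht)

lemma reciprocalBump_locallyFinite {t : ℝ} (ht : t ≠ 0) :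
    ∃ N, ∀ᶠ s in 𝓝 t, ∀ j ≥ N, reciprocalBump j s = 0 := by
  rcases ht.lt_or_gt with ht | ht
  · refine ⟨0, ?_⟩
    filter_upwards [Iio_mem_nhds ht] with s hs j _
    exact reciprocalBump_of_le (le_trans (le_of_lt hs) (by positivity))
  · obtain ⟨N, hN⟩ := exists_nat_one_div_lt (show 0 < t / 4 by positivity)
    refine ⟨N, ?_⟩
    filter_upwards [Ioi_mem_nhds (half_lt_self ht)] with s hs j hj
    refine reciprocalBump_of_two_mul_le ?_
    have h : 1 / ((j : ℝ) + 1) ≤ 1 / ((N : ℝ) + 1) := by gcongr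
    have hs' : t / 2 < s := hs
    linarith

/-- Proposition A.6 in the normed-space setting: every convergent sequence admits, after
passing to a subsequence, a smooth interpolating curve. -/
theorem smooth_curve_through_subsequence
    {F : Type*} [NormedAddCommGroup F] [NormedSpace ℝ F]
    (x : F) (xn : ℕ → F) (hx : Filter.Tendsto xn Filter.atTop (nhds x)) :
    ∃ φ : ℕ → ℕ, StrictMono φ ∧
      ∃ c : ℝ → F, ContDiff ℝ (⊤ : ℕ∞) c ∧ c 0 = x ∧
        ∀ j : ℕ, c (1 / ((j : ℝ) + 1)) = xn (φ j) := by
  choose B hB0 hB using fun j => (reciprocalBump j).hasCompactSupport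
    |>.exists_abs_iteratedDeriv_le_mul_sq_of_le (reciprocalBump j).contDiff
      (reciprocalBump_eventuallyEq_zero j) j
  obtain ⟨φ, hφ, hclose⟩ := extraction_forall_of_eventually
    (P := fun j m => ‖xn m - x‖ < (1 / 2) ^ j / B j) fun j => by
      have h := (Metric.tendsto_nhds.1 hx) ((1 / 2) ^ j / B j)
        (div_pos (by positivity) (hB0 j))
      simpa only [dist_eq_norm] using h
  refine ⟨φ, hφ, fun t => x + ∑' j, reciprocalBump j t • (xn (φ j) - x), ?_, ?_, fun j => ?_⟩
  · refine contDiff_const.add (contDiff_infty.2 fun n =>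
      contDiff_nat_tsum_of_locallyFinite_away_from_zero summable_geometric_two
        (fun j => by positivity) n (fun j => (reciprocalBump j).contDiff.smul contDiff_const)
        (fun j => ?_) (fun t ht => ?_) fun k => ?_)
    · filter_upwards [reciprocalBump_eventuallyEq_zero j] with t ht
      simp [ht]
    · obtain ⟨N, hN⟩ := reciprocalBump_locallyFinite ht
      exact ⟨N, hN.mono fun s hs j hj => by simp [hs j hj]⟩
    · filter_upwards [eventually_ge_atTop k] with j hj t
      rw [iteratedDeriv_smul_const (reciprocalBump j).contDiff.contDiffAt, norm_smul,
        Real.norm_eq_abs]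
      calc |iteratedDeriv k (reciprocalBump j) t| * ‖xn (φ j) - x‖
          ≤ (B j * t ^ 2) * ((1 / 2) ^ j / B j) :=
            mul_le_mul (hB j k hj t) (hclose j).le (norm_nonneg _)
              (mul_nonneg (hB0 j).le (sq_nonneg t))
        _ = (1 / 2) ^ j * t ^ 2 := by
            have := (hB0 j).ne'
            field_simp
  · have h : ∀ j, reciprocalBump j 0 = 0 := fun j =>
      (reciprocalBump_eventuallyEq_zero j).eq_of_nhds
    simp [h]
  · beta_reduce
    rw [tsum_eq_single j fun i hi => by simp only [reciprocalBump_of_ne hi, zero_smul],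
      reciprocalBump_self, one_smul, add_sub_cancel]
end

section
/- Let E and F be finite-dimensional real normed vector spaces, U an open subset of E, and f : U → F a map. Then f is infinitely differentiable on U if and only if for every infinitely differentiable curve c : ℝ → E whose range is contained in U, the composite f ∘ c : ℝ → F is infinitely differentiable. -/
open Filter Topology Set
open scoped ContDiff fwdDiff

theorem exists_norm_iteratedFDeriv_le_of_hasCompactSupport {E F : Type*}
    [NormedAddCommGroup E] [NormedSpace ℝ E] [NormedAddCommGroup F] [NormedSpace ℝ F]
    {φ : E → F} (hφ : HasCompactSupport φ) (hs : ContDiff ℝ ∞ φ) (n : ℕ) :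
    ∃ B : ℝ, 0 < B ∧ ∀ k ≤ n, ∀ x, ‖iteratedFDeriv ℝ k φ x‖ ≤ B := by
  have h (k : ℕ) : ∃ C, ∀ x, ‖iteratedFDeriv ℝ k φ x‖ ≤ C :=
    (hφ.iteratedFDeriv k).exists_bound_of_continuous
      (hs.continuous_iteratedFDeriv (mod_cast le_top))
  choose C hC using h
  have hC0 (k : ℕ) : 0 ≤ C k := (norm_nonneg _).trans (hC k 0)
  refine ⟨1 + ∑ k ∈ Finset.range (n + 1), C k,
    add_pos_of_pos_of_nonneg one_pos (Finset.sum_nonneg fun k _ => hC0 k), fun k hk x => ?_⟩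
  have := Finset.single_le_sum (fun k _ => hC0 k) (Finset.mem_range.2 (Nat.lt_succ_of_le hk))
  linarith [hC k x]

theorem norm_iteratedFDeriv_smul_const_le {E : Type*} [NormedAddCommGroup E] [NormedSpace ℝ E]
    {φ : ℝ → ℝ} (hφ : ContDiff ℝ ∞ φ) (a : E) (k : ℕ) (r : ℝ) :
    ‖iteratedFDeriv ℝ k (fun r => φ r • a) r‖ ≤ ‖iteratedFDeriv ℝ k φ r‖ * ‖a‖ := by
  have h := (ContinuousLinearMap.toSpanSingleton ℝ a).norm_iteratedFDeriv_comp_left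
    (hφ.contDiffAt (x := r)) (n := k) (mod_cast le_top)
  rw [ContinuousLinearMap.norm_toSpanSingleton, mul_comm] at h
  exact h

/-- Special curve lemma: a sequence of short affine segments converging fast enough to a point is
traced out, near prescribed times in the unit interval, by a smooth curve. -/
theorem exists_contDiff_curve_eventually_eq_affine (E : Type*) [NormedAddCommGroup E]
    [NormedSpace ℝ E] [CompleteSpace E] :
    ∃ ε t : ℕ → ℝ, (∀ n, 0 < ε n) ∧ (∀ n, t n ∈ Icc (0 : ℝ) 1) ∧
      ∀ (x : E) (y v : ℕ → E), (∀ n, ‖y n - x‖ ≤ ε n) → (∀ n, ‖v n‖ ≤ 1) →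
        ∃ c : ℝ → E, ContDiff ℝ ∞ c ∧
          ∀ n, ∀ᶠ r in 𝓝 (t n), c r = y n + (ε n * (r - t n)) • v n := by
  set t : ℕ → ℝ := fun n => (1 / 2) ^ n with ht
  have ht0 (n : ℕ) : 0 < t n := by positivity
  have hhalf {m n : ℕ} (h : m < n) : t n ≤ t m / 2 := by
    have := pow_le_pow_of_le_one (by norm_num : (0 : ℝ) ≤ 1 / 2) (by norm_num) h
    simp only [ht, pow_succ] at this ⊢
    linarith
  let χ (n : ℕ) : ContDiffBump (t n) :=
    ⟨t n / 8, t n / 4, by have := ht0 n; positivity, by have := ht0 n; linarith⟩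
  have hχ (n : ℕ) : ContDiff ℝ ∞ (χ n) := (χ n).contDiff
  have hχ' (n : ℕ) : ContDiff ℝ ∞ (fun r => χ n r * (r - t n)) :=
    (hχ n).mul (contDiff_id.sub contDiff_const)
  choose B hB0 hB using fun n =>
    exists_norm_iteratedFDeriv_le_of_hasCompactSupport (χ n).hasCompactSupport (hχ n) n
  choose B' hB0' hB' using fun n =>
    exists_norm_iteratedFDeriv_le_of_hasCompactSupport
      (φ := fun r => χ n r * (r - t n)) ((χ n).hasCompactSupport.mul_right) (hχ' n) n
  refine ⟨fun n => t n / (B n + B' n), t, fun n => div_pos (ht0 n) (add_pos (hB0 n) (hB0' n)),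
    fun n => ⟨(ht0 n).le, pow_le_one₀ (by norm_num) (by norm_num)⟩, ?_⟩
  intro x y v hy hv
  set ε : ℕ → ℝ := fun n => t n / (B n + B' n) with hε
  have hε0 (n : ℕ) : 0 < ε n := div_pos (ht0 n) (add_pos (hB0 n) (hB0' n))
  let T (n : ℕ) (r : ℝ) : E := χ n r • (y n - x) + (χ n r * (r - t n)) • (ε n • v n)
  refine ⟨fun r => x + ∑' n, T n r, contDiff_const.add ?_, fun n => ?_⟩
  · refine contDiff_tsum_of_eventually (v := fun _ => t)
      (fun n => ((hχ n).smul contDiff_const).add ((hχ' n).smul contDiff_const))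
      (fun _ _ => summable_geometric_two) fun k _ => ?_
    rw [Nat.cofinite_eq_atTop]
    filter_upwards [eventually_ge_atTop k] with n hn r
    have h1 := norm_iteratedFDeriv_smul_const_le (hχ n) (y n - x) k r
    have h2 := norm_iteratedFDeriv_smul_const_le (hχ' n) (ε n • v n) k r
    have h3 : ‖ε n • v n‖ ≤ ε n := by
      rw [norm_smul, Real.norm_of_nonneg (hε0 n).le]
      exact mul_le_of_le_one_right (hε0 n).le (hv n)
    have h4 : iteratedFDeriv ℝ k (T n) r =
        iteratedFDeriv ℝ k (fun r => χ n r • (y n - x)) r +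
        iteratedFDeriv ℝ k (fun r => (χ n r * (r - t n)) • (ε n • v n)) r :=
      iteratedFDeriv_add_apply
        (((hχ n).smul contDiff_const).contDiffAt.of_le (mod_cast le_top))
        (((hχ' n).smul contDiff_const).contDiffAt.of_le (mod_cast le_top))
    calc ‖iteratedFDeriv ℝ k (T n) r‖ ≤ B n * ε n + B' n * ε n := by
          rw [h4]
          refine (norm_add_le _ _).trans (add_le_add (h1.trans ?_) (h2.trans ?_))
          · exact mul_le_mul (hB n k hn r) (hy n) (norm_nonneg _) (hB0 n).le
          · exact mul_le_mul (hB' n k hn r) h3 (norm_nonneg _) (hB0' n).le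
      _ = t n := by
          rw [← add_mul, hε]
          exact mul_div_cancel₀ _ (add_pos (hB0 n) (hB0' n)).ne'
  · filter_upwards [Metric.ball_mem_nhds (t n) (show 0 < t n / 8 by linarith [ht0 n])] with r hr
    have h1 : χ n r = 1 := (χ n).one_of_mem_closedBall (Metric.ball_subset_closedBall hr)
    rw [tsum_eq_single n]
    · simp only [T, h1, one_smul, one_mul, smul_smul, mul_comm (r - t n)]
      abel
    · intro m hm
      have h2 : χ m r = 0 := by
        refine (χ m).zero_of_le_dist ?_
        rw [Metric.mem_ball, Real.dist_eq, abs_lt] at hr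
        rw [Real.dist_eq]
        change t m / 4 ≤ _
        rcases lt_or_gt_of_ne hm with h | h
        · have := hhalf h
          rw [abs_sub_comm]
          exact le_trans (by linarith [ht0 n, ht0 m]) (le_abs_self _)
        · have := hhalf h
          exact le_trans (by linarith [ht0 n, ht0 m]) (le_abs_self _)
      simp [T, h2]

/-- `f` maps smooth curves to smooth curves. -/
def CurveSmooth {E F : Type*} [NormedAddCommGroup E] [NormedSpace ℝ E]
    [NormedAddCommGroup F] [NormedSpace ℝ F] (f : E → F) : Prop :=
  ∀ c : ℝ → E, ContDiff ℝ ∞ c → ContDiff ℝ ∞ (f ∘ c)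

/-- The `k`-th derivative at `0` of `r ↦ f (x + r • v)`. -/
noncomputable def iteratedLineDeriv {E F : Type*} [NormedAddCommGroup E] [NormedSpace ℝ E]
    [NormedAddCommGroup F] [NormedSpace ℝ F] (k : ℕ) (f : E → F) (x v : E) : F :=
  iteratedDeriv k (fun r : ℝ => f (x + r • v)) 0

section

variable {E F : Type*} [AddCommGroup E] [AddCommGroup F]

/-- The mixed difference `Δ_[v₁] (Δ_[v₂] (⋯ f))` along a list of increments. -/
def mixedDiff (f : E → F) (l : List E) : E → F :=
  l.foldr fwdDiff f

theorem mixedDiff_cons (f : E → F) (v : E) (l : List E) (y : E) :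
    mixedDiff f (v :: l) y = mixedDiff f l (y + v) - mixedDiff f l y := rfl

theorem mixedDiff_replicate (f : E → F) (k : ℕ) (v : E) :
    mixedDiff f (List.replicate k v) = (Δ_[v])^[k] f := by
  induction k with
  | zero => rfl
  | succ k ih =>
    rw [Function.iterate_succ_apply', ← ih]
    rfl

theorem mixedDiff_eq_zero_of_mem (f : E → F) {l : List E} (h : 0 ∈ l) (y : E) :
    mixedDiff f l y = 0 := by
  induction l generalizing y with
  | nil => simp at h
  | cons v l ih =>
    rw [mixedDiff_cons]
    rcases List.mem_cons.1 h with h | h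
    · rw [← h, add_zero, sub_self]
    · rw [ih h, ih h, sub_self]

theorem fwdDiff_iter_line [Module ℝ E] (f : E → F) (k : ℕ) (y v : E) (τ : ℝ) :
    (Δ_[τ • v])^[k] f y = (Δ_[τ])^[k] (fun r : ℝ => f (y + r • v)) 0 := by
  simp only [fwdDiff_iter_eq_sum_shift, zero_add, smul_assoc]

end

section

variable {E F : Type*} [NormedAddCommGroup E] [NormedSpace ℝ E]
  [NormedAddCommGroup F] [NormedSpace ℝ F] {f : E → F}

theorem CurveSmooth.contDiff_line (hf : CurveSmooth f) (x v : E) :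
    ContDiff ℝ ∞ (fun r : ℝ => f (x + r • v)) :=
  hf (fun r => x + r • v) (by fun_prop)

theorem CurveSmooth.continuous_iteratedDeriv_line (hf : CurveSmooth f) (k : ℕ) (x v : E) :
    Continuous (iteratedDeriv k (fun r : ℝ => f (x + r • v))) :=
  (hf.contDiff_line x v).continuous_iteratedDeriv k (mod_cast le_top)

theorem iteratedDeriv_line (k : ℕ) (f : E → F) (x v : E) (r : ℝ) :
    iteratedDeriv k (fun r : ℝ => f (x + r • v)) r = iteratedLineDeriv k f (x + r • v) v := by
  have := congrFun (iteratedDeriv_comp_const_add k (fun r : ℝ => f (x + r • v)) r) 0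
  simp only [add_zero] at this
  rw [← this, iteratedLineDeriv]
  simp only [add_smul, add_assoc]

theorem CurveSmooth.iteratedLineDeriv_smul (hf : CurveSmooth f) (k : ℕ) (x v : E) (s : ℝ) :
    iteratedLineDeriv k f x (s • v) = s ^ k • iteratedLineDeriv k f x v := by
  have := congrFun (iteratedDeriv_comp_const_smul (n := k)
    ((hf.contDiff_line x v).of_le (mod_cast le_top)) s) 0
  simp only [mul_zero] at this
  rw [iteratedLineDeriv, iteratedLineDeriv, ← this]
  simp only [smul_smul, mul_comm s]

theorem CurveSmooth.exists_norm_iteratedLineDeriv_le [CompleteSpace E] (hf : CurveSmooth f)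
    (k : ℕ) (x : E) :
    ∃ δ > 0, ∃ M ≥ 0, ∀ y ∈ Metric.ball x δ, ∀ v,
      ‖iteratedLineDeriv k f y v‖ ≤ M * ‖v‖ ^ k := by
  obtain ⟨ε, t, hε, ht, H⟩ := exists_contDiff_curve_eventually_eq_affine E
  suffices h : ∃ δ > 0, ∃ M ≥ 0, ∀ y, ‖y - x‖ ≤ δ → ∀ v, ‖v‖ ≤ 1 →
      ‖iteratedLineDeriv k f y v‖ ≤ M by
    obtain ⟨δ, hδ, M, hM0, hM⟩ := h
    refine ⟨δ, hδ, M, hM0, fun y hy v => ?_⟩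
    rw [mem_ball_iff_norm] at hy
    rcases eq_or_ne v 0 with rfl | hv
    · rcases Nat.eq_zero_or_pos k with rfl | hk
      · simpa using hM y hy.le 0 (by simp)
      · have := hf.iteratedLineDeriv_smul k y 0 0
        simp [hk.ne'] at this
        simp [this, hk.ne']
    · have hv' : 0 < ‖v‖ := norm_pos_iff.2 hv
      have h1 := hf.iteratedLineDeriv_smul k y (‖v‖⁻¹ • v) ‖v‖
      rw [smul_inv_smul₀ hv'.ne'] at h1
      rw [h1, norm_smul, norm_pow, norm_norm, mul_comm]
      refine mul_le_mul_of_nonneg_right (hM y hy.le _ ?_) (by positivity)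
      rw [norm_smul, norm_inv, norm_norm, inv_mul_cancel₀ hv'.ne']
  by_contra! hcon
  choose y hy v hv hbig using fun n : ℕ =>
    hcon (ε n) (hε n) (n / ε n ^ k) (by have := hε n; positivity)
  obtain ⟨c, hc, hcn⟩ := H x y v hy hv
  obtain ⟨C, hC⟩ := (isCompact_Icc (a := (0 : ℝ)) (b := 1)).exists_bound_of_continuousOn
    ((hf c hc).continuous_iteratedDeriv k (mod_cast le_top)).continuousOn
  obtain ⟨n, hn⟩ := exists_nat_gt C
  have h1 : f ∘ c =ᶠ[𝓝 (t n)] fun r => f ((y n - t n • ε n • v n) + r • (ε n • v n)) := by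
    filter_upwards [hcn n] with r hr
    simp only [Function.comp_apply, hr, smul_smul]
    congr 1
    module
  have h2 := hC (t n) (ht n)
  rw [h1.iteratedDeriv_eq, iteratedDeriv_line, sub_add_cancel, hf.iteratedLineDeriv_smul,
    norm_smul, norm_pow, Real.norm_of_nonneg (hε n).le] at h2
  have h3 := hbig n
  rw [div_lt_iff₀ (by have := hε n; positivity)] at h3
  linarith

theorem norm_fwdDiff_iter_sub_le {φ : ℝ → F} (hφ : ContDiff ℝ ∞ φ) (p : ℕ) {x τ ε : ℝ} (y : F)
    (hτ : 0 ≤ τ) (h : ∀ r ∈ Icc x (x + p * τ), ‖iteratedDeriv p φ r - y‖ ≤ ε) :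
    ‖(Δ_[τ])^[p] φ x - τ ^ p • y‖ ≤ τ ^ p * ε := by
  induction p generalizing φ y ε with
  | zero => simpa using h x (by simp)
  | succ p ih =>
    rw [Function.iterate_succ_apply, pow_succ, mul_smul, mul_assoc]
    have hshift : ContDiff ℝ ∞ (fun r => φ (r + τ)) := hφ.comp (by fun_prop)
    refine ih (φ := Δ_[τ] φ) (hshift.sub hφ) (τ • y) fun r hr => ?_
    have h1 : iteratedDeriv p (Δ_[τ] φ) r = iteratedDeriv p φ (r + τ) - iteratedDeriv p φ r := by
      have := iteratedDeriv_sub (n := p) (x := r) (hshift.contDiffAt.of_le (mod_cast le_top))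
        (hφ.contDiffAt.of_le (mod_cast le_top))
      rw [iteratedDeriv_comp_add_const] at this
      exact this
    have h2 (s : ℝ) : HasDerivAt (fun s => iteratedDeriv p φ s - s • y)
        (iteratedDeriv (p + 1) φ s - y) s := by
      have h3 : DifferentiableAt ℝ (iteratedDeriv p φ) s :=
        (hφ.differentiable_iteratedDeriv p (mod_cast WithTop.coe_lt_top _)) s
      have h4 := h3.hasDerivAt
      rw [← iteratedDeriv_succ] at h4
      simpa using h4.fun_sub ((hasDerivAt_id s).smul_const y)
    have h5 := norm_image_sub_le_of_norm_deriv_le_segment' (a := r) (b := r + τ)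
      (fun s _ => (h2 s).hasDerivWithinAt) (C := ε) (fun s hs => h s ⟨hr.1.trans hs.1, ?_⟩)
      (r + τ) ⟨by linarith, le_rfl⟩
    · rw [h1]
      calc _ = _ := by congr 1; module
        _ ≤ _ := h5
        _ = _ := by ring
    · have := hr.2
      have := hs.2
      push_cast
      linarith

theorem CurveSmooth.contDiff_mixedDiff_line (hf : CurveSmooth f) (L : List (E × E)) (y z : E) :
    ContDiff ℝ ∞ fun r : ℝ => mixedDiff f (L.map fun p => p.1 + r • p.2) (y + r • z) := by
  induction L generalizing y z with
  | nil => exact hf.contDiff_line y z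
  | cons p L ih =>
    have := (ih (y + p.1) (z + p.2)).sub (ih y z)
    convert this using 2 with r
    rw [List.map_cons, mixedDiff_cons]
    congr 2
    module

theorem CurveSmooth.norm_iteratedDeriv_mixedDiff_line_le (hf : CurveSmooth f) {n : ℕ} {x : E}
    {δ M τ : ℝ} (hM : 0 ≤ M) (hτ : 0 ≤ τ)
    (hb : ∀ y ∈ Metric.ball x δ, ∀ v, ‖iteratedLineDeriv n f y v‖ ≤ M * ‖v‖ ^ n)
    {r : ℝ} (hr : 0 ≤ r) (K : ℝ) (L : List (E × E)) (hL : ∀ p ∈ L, ‖p.1‖ ≤ τ ∧ ‖p.2‖ ≤ τ)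
    (y z : E) (hy : ‖y - x‖ + r * ‖z‖ + (1 + r) * (L.length * τ) < δ)
    (hz : ‖z‖ + L.length * τ ≤ K) :
    ‖iteratedDeriv n (fun r : ℝ => mixedDiff f (L.map fun p => p.1 + r • p.2) (y + r • z)) r‖ ≤
      2 ^ L.length * (M * K ^ n) := by
  induction L generalizing y z with
  | nil =>
    simp only [List.length_nil, Nat.cast_zero, zero_mul, mul_zero, add_zero] at hy hz
    simp only [List.map_nil, List.length_nil, pow_zero, one_mul]
    change ‖iteratedDeriv n (fun r : ℝ => f (y + r • z)) r‖ ≤ _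
    rw [iteratedDeriv_line]
    refine (hb _ ?_ z).trans ?_
    · rw [mem_ball_iff_norm, add_sub_right_comm]
      refine (norm_add_le _ _).trans_lt ?_
      rwa [norm_smul, Real.norm_of_nonneg hr]
    · gcongr
  | cons p L ih =>
    obtain ⟨hp1, hp2⟩ := hL p (by simp)
    have hL' : ∀ q ∈ L, ‖q.1‖ ≤ τ ∧ ‖q.2‖ ≤ τ := fun q hq => hL q (by simp [hq])
    simp only [List.length_cons, Nat.cast_add, Nat.cast_one] at hy hz ⊢
    have h1 : ‖y + p.1 - x‖ ≤ ‖y - x‖ + τ := by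
      rw [add_sub_right_comm]
      exact (norm_add_le _ _).trans (by gcongr)
    have h2 : ‖z + p.2‖ ≤ ‖z‖ + τ := (norm_add_le _ _).trans (by gcongr)
    have h3 : r * ‖z + p.2‖ ≤ r * ‖z‖ + r * τ := by
      rw [← mul_add]
      gcongr
    have h4 : 0 ≤ r * τ := by positivity
    have hA := ih hL' (y + p.1) (z + p.2) (by linarith) (by linarith)
    have hB := ih hL' y z (by linarith) (by linarith)
    have hc1 := hf.contDiff_mixedDiff_line L (y + p.1) (z + p.2)
    have hc2 := hf.contDiff_mixedDiff_line L y z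
    have h5 : (fun r : ℝ => mixedDiff f ((p :: L).map fun p => p.1 + r • p.2) (y + r • z)) =
        (fun r : ℝ => mixedDiff f (L.map fun p => p.1 + r • p.2) (y + p.1 + r • (z + p.2))) -
        fun r : ℝ => mixedDiff f (L.map fun p => p.1 + r • p.2) (y + r • z) := by
      funext r
      rw [List.map_cons, mixedDiff_cons, Pi.sub_apply]
      congr 2
      module
    rw [h5, iteratedDeriv_sub (hc1.contDiffAt.of_le (mod_cast le_top))
      (hc2.contDiffAt.of_le (mod_cast le_top))]
    refine (norm_sub_le _ _).trans ((add_le_add hA hB).trans_eq ?_)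
    ring

/-- Bounds on pure directional derivatives control mixed differences. -/
theorem CurveSmooth.exists_norm_mixedDiff_le [CompleteSpace E] (hf : CurveSmooth f)
    (n : ℕ) (x : E) :
    ∃ δ > 0, ∃ C ≥ 0, ∀ y ∈ Metric.ball x δ, ∀ τ, 0 ≤ τ → τ ≤ δ →
      ∀ l : List E, l.length = n → (∀ v ∈ l, ‖v‖ ≤ τ) → ‖mixedDiff f l y‖ ≤ C * τ ^ n := by
  obtain ⟨δ, hδ, M, hM, hb⟩ := hf.exists_norm_iteratedLineDeriv_le n x
  have hD : (0 : ℝ) < 1 + (1 + n) * n := by positivity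
  refine ⟨δ / (1 + (1 + n) * n) / 2, by positivity, 2 ^ n * (M * n ^ n), by positivity, ?_⟩
  intro y hy τ hτ hτδ l hl hv
  subst hl
  set n := l.length with hn
  let L : List (E × E) :=
    List.ofFn fun j : Fin n => (l.get j, -((j : ℝ) + 1)⁻¹ • l.get j)
  have hLlen : L.length = n := by simp [L]
  have hL : ∀ p ∈ L, ‖p.1‖ ≤ τ ∧ ‖p.2‖ ≤ τ := by
    intro p hp
    obtain ⟨j, rfl⟩ := (List.mem_ofFn' _ _).1 hp
    have h1 := hv (l.get j) (List.get_mem l j)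
    refine ⟨h1, ?_⟩
    rw [norm_smul, norm_neg, norm_inv, Real.norm_of_nonneg (by positivity)]
    exact (mul_le_of_le_one_left (norm_nonneg _)
      (inv_le_one_of_one_le₀ (by linarith [(j : ℕ).cast_nonneg (α := ℝ)]))).trans h1
  let G : ℝ → F := fun r => mixedDiff f (L.map fun p => p.1 + r • p.2) (y + r • 0)
  have hG : ContDiff ℝ ∞ G := hf.contDiff_mixedDiff_line L y 0
  have hG0 : G 0 = mixedDiff f l y := by
    simp only [G, L, List.map_ofFn, zero_smul, add_zero]
    congr 1
    exact List.ofFn_get l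
  have hGi : ∀ i ∈ Finset.range n, G (i + 1) = 0 := by
    intro i hi
    refine mixedDiff_eq_zero_of_mem f ?_ _
    rw [List.mem_map]
    refine ⟨_, (List.mem_ofFn' _ _).2 ⟨⟨i, Finset.mem_range.1 hi⟩, rfl⟩, ?_⟩
    have : (i : ℝ) + 1 ≠ 0 := by positivity
    simp [smul_smul, this]
  have hdiff : ‖(Δ_[(1 : ℝ)])^[n] G 0‖ = ‖G 0‖ := by
    rw [fwdDiff_iter_eq_sum_shift, Finset.sum_range_succ', Finset.sum_eq_zero]
    · rcases neg_one_pow_eq_or ℤ n with h | h <;> simp [h]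
    · intro i hi
      have := hGi i hi
      simp [this]
  have hbound := norm_fwdDiff_iter_sub_le hG n (x := 0) (τ := 1) (ε := 2 ^ n * (M * (n * τ) ^ n))
    0 zero_le_one fun r hr => by
      rw [sub_zero]
      have hrn : r ≤ n := by simpa using hr.2
      have := hf.norm_iteratedDeriv_mixedDiff_line_le hM hτ hb hr.1 (n * τ) L hL y 0 ?_ ?_
      · rwa [hLlen] at this
      · rw [hLlen, norm_zero, mul_zero, add_zero]
        rw [mem_ball_iff_norm] at hy
        have h1 : (1 + r) * (n * τ) ≤ (1 + n) * (n * (δ / (1 + (1 + n) * n) / 2)) := by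
          have := hr.1
          gcongr
        have h2 : δ / (1 + (1 + n) * n) / 2 + (1 + n) * (n * (δ / (1 + (1 + n) * n) / 2))
            = δ / 2 := by
          field_simp
        linarith
      · rw [hLlen, norm_zero, zero_add]
  rw [smul_zero, sub_zero, hdiff, hG0] at hbound
  refine hbound.trans_eq ?_
  rw [mul_pow]
  ring

theorem CurveSmooth.tendsto_fwdDiff_iter (hf : CurveSmooth f) (k : ℕ) (y v : E) :
    Tendsto (fun τ : ℝ => (τ ^ k)⁻¹ • (Δ_[τ • v])^[k] f y) (𝓝[>] 0)
      (𝓝 (iteratedLineDeriv k f y v)) := by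
  rw [Metric.tendsto_nhds]
  intro ε hε
  have hc := (hf.continuous_iteratedDeriv_line k y v).continuousAt (x := 0)
  obtain ⟨η, hη, H⟩ := Metric.continuousAt_iff.1 hc (ε / 2) (half_pos hε)
  have hev : ∀ᶠ τ : ℝ in 𝓝[>] 0, τ < η / (k + 1) :=
    nhdsWithin_le_nhds (Iio_mem_nhds (by positivity))
  filter_upwards [hev, self_mem_nhdsWithin] with τ hτ hτ0
  replace hτ0 : 0 < τ := hτ0
  have h1 := norm_fwdDiff_iter_sub_le (hf.contDiff_line y v) k (x := 0) (ε := ε / 2)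
    (iteratedLineDeriv k f y v) hτ0.le fun r hr => by
      have h2 : r < η := by
        rw [lt_div_iff₀ (by positivity)] at hτ
        have := hr.2
        linarith
      have h3 := H (x := r) (by rw [Real.dist_eq, sub_zero, abs_of_nonneg hr.1]; exact h2)
      rw [dist_eq_norm] at h3
      exact h3.le
  rw [← fwdDiff_iter_line] at h1
  have hk : (0 : ℝ) < τ ^ k := by positivity
  have h4 : (τ ^ k)⁻¹ • (Δ_[τ • v])^[k] f y - iteratedLineDeriv k f y v =
      (τ ^ k)⁻¹ • ((Δ_[τ • v])^[k] f y - τ ^ k • iteratedLineDeriv k f y v) := by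
    rw [smul_sub, inv_smul_smul₀ hk.ne']
  rw [dist_eq_norm, h4, norm_smul, norm_inv, Real.norm_of_nonneg hk.le, inv_mul_lt_iff₀ hk]
  exact h1.trans_lt (mul_lt_mul_of_pos_left (by linarith) hk)

theorem CurveSmooth.exists_norm_iteratedLineDeriv_sub_le [CompleteSpace E] (hf : CurveSmooth f)
    (k : ℕ) (x a b : E) :
    ∃ ρ > 0, ∃ C : ℝ, ∀ y ∈ Metric.ball x ρ, ∀ σ, 0 < σ → σ < ρ →
      ‖iteratedLineDeriv k f (y + σ • a) b - iteratedLineDeriv k f y b‖ ≤ C * σ := by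
  obtain ⟨δ, hδ, C, hC0, hC⟩ := hf.exists_norm_mixedDiff_le (k + 1) x
  set K : ℝ := 1 + ‖a‖ + ‖b‖ with hK
  have hK1 : 1 ≤ K := by linarith [norm_nonneg a, norm_nonneg b]
  have haK : ‖a‖ ≤ K := by linarith [norm_nonneg b]
  have hbK : ‖b‖ ≤ K := by linarith [norm_nonneg a]
  refine ⟨δ / (2 * K), by positivity, C * K ^ (k + 1), fun y hy σ hσ hσρ => ?_⟩
  rw [lt_div_iff₀ (by positivity)] at hσρ
  rw [mem_ball_iff_norm, lt_div_iff₀ (by positivity)] at hy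
  have hyδ : ‖y - x‖ < δ / 2 := by nlinarith [norm_nonneg (y - x)]
  let τ (N : ℕ) : ℝ := σ * (1 / ((N : ℝ) + 1))
  have hτ0 (N : ℕ) : 0 < τ N := by positivity
  have hτN (N : ℕ) : (N + 1) * τ N = σ := by
    simp only [τ]
    field_simp
  have hτlim : Tendsto τ atTop (𝓝[>] 0) := by
    refine tendsto_nhdsWithin_iff.2 ⟨?_, Eventually.of_forall hτ0⟩
    simpa [τ] using (tendsto_one_div_add_atTop_nhds_zero_nat (𝕜 := ℝ)).const_mul σ
  have hlim := ((hf.tendsto_fwdDiff_iter k (y + σ • a) b).comp hτlim).sub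
    ((hf.tendsto_fwdDiff_iter k y b).comp hτlim)
  refine le_of_tendsto hlim.norm (Eventually.of_forall fun N => ?_)
  simp only [Function.comp_apply]
  set Φ := (Δ_[τ N • b])^[k] f with hΦ
  have hN1 : (1 : ℝ) ≤ N + 1 := by linarith [N.cast_nonneg (α := ℝ)]
  have hτσ : τ N ≤ σ := by nlinarith [hτ0 N, hτN N]
  have hstep (i : ℕ) (hi : i < N + 1) :
      ‖Φ (y + (i * τ N) • a + τ N • a) - Φ (y + (i * τ N) • a)‖ ≤ C * (τ N * K) ^ (k + 1) := by
    rw [hΦ, ← mixedDiff_replicate, ← mixedDiff_cons]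
    refine hC _ ?_ _ (by have := hτ0 N; positivity) ?_ _ (by simp) ?_
    · have hi' : (i : ℝ) * τ N ≤ σ := by
        rw [← hτN N]
        have := hτ0 N
        gcongr
        exact_mod_cast hi.le
      rw [mem_ball_iff_norm, add_sub_right_comm]
      refine (norm_add_le _ _).trans_lt ?_
      rw [norm_smul, Real.norm_of_nonneg (by have := hτ0 N; positivity)]
      have : i * τ N * ‖a‖ ≤ σ * K := by gcongr
      linarith
    · nlinarith
    · intro v hv
      have hcase : v = τ N • a ∨ v = τ N • b := by
        rcases List.mem_cons.1 hv with h | h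
        · exact Or.inl h
        · exact Or.inr (List.eq_of_mem_replicate h)
      rcases hcase with rfl | rfl <;>
      · rw [norm_smul, Real.norm_of_nonneg (hτ0 N).le]
        have := (hτ0 N).le
        gcongr
  have hsum : ‖Φ (y + σ • a) - Φ y‖ ≤ (N + 1) * (C * (τ N * K) ^ (k + 1)) := by
    have h1 := Finset.sum_range_sub (fun i : ℕ => Φ (y + (i * τ N) • a)) (N + 1)
    simp only [Nat.cast_add, Nat.cast_one, hτN, Nat.cast_zero, zero_mul, zero_smul,
      add_zero] at h1
    rw [← h1]
    refine (norm_sum_le_of_le (n := fun _ => C * (τ N * K) ^ (k + 1)) _ fun i hi => ?_).trans_eq ?_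
    · rw [show y + ((i + 1) * τ N) • a = y + (i * τ N) • a + τ N • a by module]
      exact hstep i (Finset.mem_range.1 hi)
    · simp
  have hk : (0 : ℝ) < τ N ^ k := pow_pos (hτ0 N) k
  rw [← smul_sub, norm_smul, norm_inv, Real.norm_of_nonneg hk.le, inv_mul_le_iff₀ hk]
  refine hsum.trans_eq ?_
  calc _ = τ N ^ k * (C * K ^ (k + 1) * ((N + 1) * τ N)) := by
        rw [mul_pow]
        ring
    _ = _ := by rw [hτN]

theorem norm_sub_sub_smul_deriv_le {ψ : ℝ → F} (hψ : ContDiff ℝ ∞ ψ) {s t M : ℝ}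
    (h : ∀ r ∈ uIcc s t, ‖iteratedDeriv 2 ψ r‖ ≤ M) :
    ‖ψ t - ψ s - (t - s) • deriv ψ s‖ ≤ M * |t - s| ^ 2 := by
  have hM : 0 ≤ M := (norm_nonneg _).trans (h s left_mem_uIcc)
  have hd1 (r : ℝ) : HasDerivAt ψ (deriv ψ r) r :=
    (hψ.differentiable (by simp) r).hasDerivAt
  have hd2 (r : ℝ) : HasDerivAt (deriv ψ) (iteratedDeriv 2 ψ r) r := by
    have := (hψ.differentiable_iteratedDeriv 1 (mod_cast WithTop.coe_lt_top _) r).hasDerivAt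
    rwa [← iteratedDeriv_succ, iteratedDeriv_one] at this
  have h1 : ∀ r ∈ uIcc s t, ‖deriv ψ r - deriv ψ s‖ ≤ M * |t - s| := fun r hr => by
    refine ((convex_uIcc s t).norm_image_sub_le_of_norm_hasDerivWithin_le
      (fun r _ => (hd2 r).hasDerivWithinAt) h left_mem_uIcc hr).trans ?_
    gcongr
    exact abs_sub_left_of_mem_uIcc hr
  have h2 := (convex_uIcc s t).norm_image_sub_le_of_norm_hasDerivWithin_le
    (f := fun r => ψ r - r • deriv ψ s) (f' := fun r => deriv ψ r - deriv ψ s)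
    (fun r _ => by
      have := (hd1 r).fun_sub ((hasDerivAt_id r).smul_const (deriv ψ s))
      rw [one_smul] at this
      exact this.hasDerivWithinAt) h1 left_mem_uIcc right_mem_uIcc
  calc _ = _ := by congr 1; module
    _ ≤ _ := h2
    _ = _ := by rw [Real.norm_eq_abs]; ring

/-- A pointwise limit of smooth functions with locally uniformly bounded derivatives is smooth. -/
theorem contDiff_of_tendsto_of_bounded_iteratedDeriv [CompleteSpace F] {g : ℕ → ℝ → F} {G : ℝ → F}
    (hg : ∀ m, ContDiff ℝ ∞ (g m))
    (hb : ∀ k t₀, ∃ δ > 0, ∃ M, ∀ᶠ m in atTop, ∀ t ∈ Metric.ball t₀ δ,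
      ‖iteratedDeriv k (g m) t‖ ≤ M)
    (hlim : ∀ t, Tendsto (fun m => g m t) atTop (𝓝 (G t))) : ContDiff ℝ ∞ G := by
  have key {g : ℕ → ℝ → F} {G : ℝ → F} (hg : ∀ m, ContDiff ℝ ∞ (g m))
      (hb : ∀ k t₀, ∃ δ > 0, ∃ M, ∀ᶠ m in atTop, ∀ t ∈ Metric.ball t₀ δ,
        ‖iteratedDeriv k (g m) t‖ ≤ M)
      (hlim : ∀ t, Tendsto (fun m => g m t) atTop (𝓝 (G t))) (s : ℝ) :
      ∃ d, HasDerivAt G d s ∧ Tendsto (fun m => deriv (g m) s) atTop (𝓝 d) := by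
    obtain ⟨δ, hδ, M, hM⟩ := hb 2 s
    have hquad : ∀ᶠ m in atTop, ∀ t ∈ Metric.ball s δ,
        ‖g m t - g m s - (t - s) • deriv (g m) s‖ ≤ M * |t - s| ^ 2 := by
      filter_upwards [hM] with m hm t ht
      exact norm_sub_sub_smul_deriv_le (hg m) fun r hr => hm r
        ((convex_ball s δ).ordConnected.uIcc_subset (Metric.mem_ball_self hδ) ht hr)
    have hM0 : 0 ≤ M := by
      obtain ⟨m, hm⟩ := hM.exists
      exact (norm_nonneg _).trans (hm s (Metric.mem_ball_self hδ))
    have hcauchy : CauchySeq fun m => deriv (g m) s := by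
      rw [Metric.cauchySeq_iff']
      intro ε hε
      obtain ⟨u, hu0, hu⟩ : ∃ u, 0 < u ∧ u < min δ (ε / (3 * (M + 1))) :=
        exists_between (by positivity)
      have huδ := hu.trans_le (min_le_left _ _)
      have huε := hu.trans_le (min_le_right _ _)
      rw [lt_div_iff₀ (by positivity)] at huε
      have hq := (((hlim (s + u)).sub (hlim s)).const_smul u⁻¹).cauchySeq
      obtain ⟨N₁, hN₁⟩ := Metric.cauchySeq_iff.1 hq (ε / 3) (by positivity)
      obtain ⟨N₂, hN₂⟩ := eventually_atTop.1 hquad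
      have hclose (m : ℕ) (hm : N₂ ≤ m) :
          dist (deriv (g m) s) (u⁻¹ • (g m (s + u) - g m s)) < ε / 3 := by
        have h1 := hN₂ m hm (s + u) (by simpa [abs_of_pos hu0] using huδ)
        rw [add_sub_cancel_left, abs_of_pos hu0] at h1
        have h2 : u⁻¹ • (g m (s + u) - g m s) - deriv (g m) s =
            u⁻¹ • (g m (s + u) - g m s - u • deriv (g m) s) := by
          rw [smul_sub _ _ (u • _), inv_smul_smul₀ hu0.ne']
        rw [dist_comm, dist_eq_norm, h2, norm_smul, norm_inv, Real.norm_of_nonneg hu0.le,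
          inv_mul_lt_iff₀ hu0]
        nlinarith
      refine ⟨max N₁ N₂, fun n hn => ?_⟩
      have h1 := hclose n (le_of_max_le_right hn)
      have h2 := hclose (max N₁ N₂) (le_max_right _ _)
      have h3 := hN₁ n (le_of_max_le_left hn) (max N₁ N₂) (le_max_left _ _)
      rw [dist_comm] at h2
      refine (dist_triangle4 _ _ _ _).trans_lt ((add_lt_add (add_lt_add h1 h3) h2).trans_eq ?_)
      ring
    obtain ⟨d, hd⟩ := cauchySeq_tendsto_of_complete hcauchy
    refine ⟨d, ?_, hd⟩
    rw [hasDerivAt_iff_isLittleO]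
    refine Asymptotics.IsBigO.trans_isLittleO (g := fun t => |t - s| ^ 2) ?_ ?_
    · refine Asymptotics.IsBigO.of_bound M ?_
      filter_upwards [Metric.ball_mem_nhds s hδ] with t ht
      rw [Real.norm_of_nonneg (by positivity)]
      refine le_of_tendsto (((hlim t).sub (hlim s)).sub (hd.const_smul (t - s))).norm ?_
      filter_upwards [hquad] with m hm
      exact hm t ht
    · have := (Asymptotics.isLittleO_pow_sub_sub s (one_lt_two)).norm_left
      simpa [norm_pow] using this
  rw [contDiff_infty]
  intro n
  induction n generalizing g G with
  | zero =>
    rw [Nat.cast_zero, contDiff_zero, continuous_iff_continuousAt]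
    intro s
    obtain ⟨d, hd, -⟩ := key hg hb hlim s
    exact hd.continuousAt
  | succ n ih =>
    choose d hd hdlim using key hg hb hlim
    rw [Nat.cast_succ, contDiff_succ_iff_deriv]
    refine ⟨fun s => (hd s).differentiableAt, by simp, ?_⟩
    refine ih (g := fun m => deriv (g m)) (fun m => (contDiff_infty_iff_deriv.1 (hg m)).2)
      (fun k t₀ => ?_) fun s => ?_
    · simpa only [iteratedDeriv_succ'] using hb (k + 1) t₀
    · rw [(hd s).deriv]
      exact hdlim s

theorem CurveSmooth.curveSmooth_iteratedLineDeriv_one [CompleteSpace F] (hf : CurveSmooth f)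
    (w : E) : CurveSmooth fun x => iteratedLineDeriv 1 f x w := by
  intro c hc
  let h : ℝ × ℝ → F := fun p => f (c p.2 + p.1 • w)
  have hh : CurveSmooth h := fun γ hγ => hf (fun r => c (γ r).2 + (γ r).1 • w)
    ((hc.comp hγ.snd).add (hγ.fst.smul contDiff_const))
  have hsm (s : ℝ) : ContDiff ℝ ∞ fun t => h (s, t) :=
    hh (fun t => (s, t)) (contDiff_const.prodMk contDiff_id)
  have hder (k : ℕ) (s t : ℝ) :
      iteratedDeriv k (fun t => h (s, t)) t = iteratedLineDeriv k h (s, t) (0, 1) := by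
    simpa using iteratedDeriv_line k h (s, 0) (0, 1) t
  let σ (m : ℕ) : ℝ := 1 / ((m : ℝ) + 1)
  have hσ0 (m : ℕ) : 0 < σ m := by positivity
  have hσ : Tendsto σ atTop (𝓝 0) := tendsto_one_div_add_atTop_nhds_zero_nat
  have hσ' : Tendsto σ atTop (𝓝[>] 0) :=
    tendsto_nhdsWithin_iff.2 ⟨hσ, Eventually.of_forall hσ0⟩
  refine contDiff_of_tendsto_of_bounded_iteratedDeriv
    (g := fun m t => (σ m)⁻¹ • (h (σ m, t) - h (0, t)))
    (fun m => contDiff_const.smul ((hsm _).sub (hsm _))) (fun k t₀ => ?_) fun t => ?_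
  · obtain ⟨ρ, hρ, C, hC⟩ := hh.exists_norm_iteratedLineDeriv_sub_le k (0, t₀) (1, 0) (0, 1)
    refine ⟨ρ, hρ, C, ?_⟩
    filter_upwards [hσ.eventually (Iio_mem_nhds hρ)] with m hm t ht
    have h1 := hC (0, t) (by simpa [Prod.dist_eq, hρ] using ht) (σ m) (hσ0 m) hm
    have h2 : (0, t) + σ m • ((1, 0) : ℝ × ℝ) = (σ m, t) := by simp
    rw [h2, ← hder, ← hder] at h1
    rw [iteratedDeriv_fun_const_smul_field, iteratedDeriv_fun_sub
      ((hsm _).contDiffAt.of_le (mod_cast le_top)) ((hsm _).contDiffAt.of_le (mod_cast le_top)),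
      norm_smul, norm_inv, Real.norm_of_nonneg (hσ0 m).le, inv_mul_le_iff₀ (hσ0 m), mul_comm]
    exact h1
  · simpa [h, fwdDiff, Function.comp_def] using
      (hf.tendsto_fwdDiff_iter 1 (c t) w).comp hσ'

theorem CurveSmooth.iteratedLineDeriv_one_add [CompleteSpace E] (hf : CurveSmooth f) (x u v : E) :
    iteratedLineDeriv 1 f x (u + v) = iteratedLineDeriv 1 f x u + iteratedLineDeriv 1 f x v := by
  obtain ⟨δ, hδ, C, hC0, hC⟩ := hf.exists_norm_mixedDiff_le 2 x
  have h1 := ((hf.tendsto_fwdDiff_iter 1 x (u + v)).sub (hf.tendsto_fwdDiff_iter 1 x u)).sub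
    (hf.tendsto_fwdDiff_iter 1 x v)
  set K : ℝ := 1 + ‖u‖ + ‖v‖ with hK
  have huK : ‖u‖ ≤ K := by linarith [norm_nonneg v]
  have hvK : ‖v‖ ≤ K := by linarith [norm_nonneg u]
  have hK0 : 0 < K := by positivity
  have h2 : Tendsto (fun τ : ℝ => τ * (C * K ^ 2)) (𝓝[>] 0) (𝓝 0) := by
    have : Tendsto (fun τ : ℝ => τ * (C * K ^ 2)) (𝓝 0) (𝓝 (0 * (C * K ^ 2))) :=
      tendsto_id.mul_const _
    rw [zero_mul] at this
    exact this.mono_left nhdsWithin_le_nhds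
  have h3 := squeeze_zero_norm' (f := fun τ : ℝ => (τ ^ 1)⁻¹ • (Δ_[τ • (u + v)])^[1] f x -
    (τ ^ 1)⁻¹ • (Δ_[τ • u])^[1] f x - (τ ^ 1)⁻¹ • (Δ_[τ • v])^[1] f x) ?_ h2
  · have h4 := tendsto_nhds_unique h1 h3
    rwa [sub_sub, sub_eq_zero] at h4
  · have hev : ∀ᶠ τ : ℝ in 𝓝[>] 0, τ < δ / K :=
      nhdsWithin_le_nhds (Iio_mem_nhds (by positivity))
    filter_upwards [hev, self_mem_nhdsWithin] with τ hτ hτ0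
    replace hτ0 : 0 < τ := hτ0
    rw [lt_div_iff₀ hK0] at hτ
    have h5 := hC x (Metric.mem_ball_self hδ) (τ * K) (by positivity) hτ.le [τ • u, τ • v] rfl
      (by
        have (z : E) (hz : ‖z‖ ≤ K) : ‖τ • z‖ ≤ τ * K := by
          rw [norm_smul, Real.norm_of_nonneg hτ0.le]
          gcongr
        simpa using ⟨this u huK, this v hvK⟩)
    have h6 : mixedDiff f [τ • u, τ • v] x =
        Δ_[τ • (u + v)] f x - Δ_[τ • u] f x - Δ_[τ • v] f x := by
      simp only [mixedDiff, List.foldr_cons, List.foldr_nil, fwdDiff, smul_add, add_assoc]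
      abel
    rw [pow_one, Function.iterate_one, Function.iterate_one, Function.iterate_one, ← smul_sub,
      ← smul_sub, ← h6, norm_smul, norm_inv, Real.norm_of_nonneg hτ0.le, inv_mul_le_iff₀ hτ0]
    exact h5.trans_eq (by ring)

theorem CurveSmooth.hasFDerivAt [FiniteDimensional ℝ E] (hf : CurveSmooth f) (x : E) :
    ∃ L : E →L[ℝ] F, HasFDerivAt f L x ∧ ∀ v, L v = iteratedLineDeriv 1 f x v := by
  have : CompleteSpace E := FiniteDimensional.complete ℝ E
  let L : E →ₗ[ℝ] F :=
    { toFun := iteratedLineDeriv 1 f x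
      map_add' := hf.iteratedLineDeriv_one_add x
      map_smul' := fun s v => by simpa using hf.iteratedLineDeriv_smul 1 x v s }
  refine ⟨LinearMap.toContinuousLinearMap L, ?_, fun v => rfl⟩
  obtain ⟨δ, hδ, M, hM0, hM⟩ := hf.exists_norm_iteratedLineDeriv_le 2 x
  rw [hasFDerivAt_iff_isLittleO_nhds_zero]
  refine Asymptotics.IsBigO.trans_isLittleO (g := fun v => ‖v‖ ^ 2) ?_ ?_
  · refine Asymptotics.IsBigO.of_bound M ?_
    filter_upwards [Metric.ball_mem_nhds (0 : E) hδ] with v hv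
    rw [mem_ball_zero_iff] at hv
    have h1 := norm_sub_sub_smul_deriv_le (hf.contDiff_line x v) (s := 0) (t := 1)
      (M := M * ‖v‖ ^ 2) fun r hr => by
        rw [uIcc_of_le zero_le_one] at hr
        rw [iteratedDeriv_line]
        refine hM _ ?_ v
        rw [mem_ball_iff_norm, add_sub_cancel_left, norm_smul, Real.norm_of_nonneg hr.1]
        exact (mul_le_of_le_one_left (norm_nonneg v) hr.2).trans_lt hv
    rw [← iteratedDeriv_one] at h1
    simp only [one_smul, zero_smul, add_zero, sub_zero, abs_one, one_pow, mul_one] at h1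
    rw [Real.norm_of_nonneg (by positivity)]
    exact h1
  · have := (Asymptotics.isLittleO_pow_id (𝕜 := ℝ) one_lt_two).comp_tendsto
      (tendsto_norm_zero (E := E))
    exact this.norm_right.congr_right (by simp) |>.of_norm_right

theorem CurveSmooth.contDiff [FiniteDimensional ℝ E] [CompleteSpace F] (hf : CurveSmooth f) :
    ContDiff ℝ ∞ f := by
  rw [contDiff_infty]
  intro n
  have hd {f : E → F} (hf : CurveSmooth f) : Differentiable ℝ f := fun x => by
    obtain ⟨L, hL, -⟩ := hf.hasFDerivAt x
    exact hL.differentiableAt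
  induction n generalizing f with
  | zero =>
    rw [Nat.cast_zero, contDiff_zero]
    exact (hd hf).continuous
  | succ n ih =>
    rw [Nat.cast_succ, contDiff_succ_iff_fderiv_apply]
    refine ⟨hd hf, by simp, fun v => ?_⟩
    convert ih (hf.curveSmooth_iteratedLineDeriv_one v) using 2 with x
    obtain ⟨L, hL, hLv⟩ := hf.hasFDerivAt x
    rw [hL.fderiv, hLv]

end

/-- A neighbourhood of `t` can be reparametrized smoothly by the whole line, fixing the points
near `t`. -/
theorem exists_contDiff_eventuallyEq_id_mem_ball (t : ℝ) {δ : ℝ} (hδ : 0 < δ) :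
    ∃ θ : ℝ → ℝ, ContDiff ℝ ∞ θ ∧ (∀ᶠ r in 𝓝 t, θ r = r) ∧ ∀ r, θ r ∈ Metric.ball t δ := by
  let χ : ContDiffBump t := ⟨δ / 2, δ, half_pos hδ, half_lt_self hδ⟩
  refine ⟨fun r => t + χ r * (r - t),
    contDiff_const.add (χ.contDiff.mul (contDiff_id.sub contDiff_const)), ?_, fun r => ?_⟩
  · filter_upwards [χ.eventuallyEq_one] with r hr
    simp [hr]
  · rw [Metric.mem_ball, dist_self_add_left, norm_mul, Real.norm_of_nonneg χ.nonneg]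
    rcases lt_or_ge (dist r t) δ with h | h
    · exact (mul_le_of_le_one_left (norm_nonneg _) χ.le_one).trans_lt h
    · rw [χ.zero_of_le_dist h, zero_mul]
      exact hδ


/-- Boman's theorem (the finite-dimensional case of Proposition A.2): a map defined on an
open set `U` of a finite-dimensional real normed space is smooth on `U` iff its composite
with every smooth curve of `ℝ` with range inside `U` is smooth. -/
theorem boman_curve_smoothness
    {E F : Type*} [NormedAddCommGroup E] [NormedSpace ℝ E] [FiniteDimensional ℝ E]
    [NormedAddCommGroup F] [NormedSpace ℝ F] [FiniteDimensional ℝ F]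
    (U : Set E) (hU : IsOpen U) (f : E → F) :
    ContDiffOn ℝ (⊤ : ℕ∞) f U ↔
      ∀ c : ℝ → E, ContDiff ℝ (⊤ : ℕ∞) c → Set.range c ⊆ U → ContDiff ℝ (⊤ : ℕ∞) (f ∘ c) := by
  refine ⟨fun hf c hc hcU => hf.comp_contDiff hc fun t => hcU (mem_range_self t), fun H x hx => ?_⟩
  have : CompleteSpace F := FiniteDimensional.complete ℝ F
  obtain ⟨δ, hδ, hδU⟩ := Metric.isOpen_iff.1 hU x hx
  let χ : ContDiffBump x := ⟨δ / 4, δ / 2, by positivity, by linarith⟩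
  have hχU : Metric.closedBall x χ.rOut ⊆ U :=
    (Metric.closedBall_subset_ball (half_lt_self hδ)).trans hδU
  have hcurve : CurveSmooth fun y => χ y • f y := by
    intro c hc
    rw [contDiff_iff_contDiffAt]
    intro t
    by_cases ht : c t ∈ U
    · obtain ⟨η, hη, hηU⟩ := Metric.isOpen_iff.1 (hU.preimage hc.continuous) t ht
      obtain ⟨θ, hθ, hθt, hθη⟩ := exists_contDiff_eventuallyEq_id_mem_ball t hη
      have h1 := H (c ∘ θ) (hc.comp hθ) (range_subset_iff.2 fun r => hηU (hθη r))
      have h2 : ContDiff ℝ ∞ fun r => χ (c r) • (f ∘ (c ∘ θ)) r := (χ.contDiff.comp hc).smul h1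
      refine h2.contDiffAt.congr_of_eventuallyEq ?_
      filter_upwards [hθt] with r hr
      simp [hr]
    · refine (contDiffAt_const (c := (0 : F))).congr_of_eventuallyEq ?_
      have h1 : c ⁻¹' (Metric.closedBall x χ.rOut)ᶜ ∈ 𝓝 t :=
        (Metric.isClosed_closedBall.isOpen_compl.preimage hc.continuous).mem_nhds
          fun h => ht (hχU h)
      filter_upwards [h1] with r hr
      have h2 : χ.rOut ≤ dist (c r) x := (not_le.1 fun h => hr h).le
      simp [χ.zero_of_le_dist h2]
  refine (hcurve.contDiff.contDiffAt.congr_of_eventuallyEq ?_).contDiffWithinAt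
  filter_upwards [χ.eventuallyEq_one] with y hy
  simp [hy]
end
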